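/- arXiv:1001.4674 — 2 statements merged into one kernel-verified Lean document; each statement's English description precedes it below -/
import Mathlib

section
/- From slightly-taller rectangles to long rectangles (Lemma 5.4): For every ε > 0 and c' > 0 there is c > 0 such that for every integer n ≥ 1: if Pr(V([0,n]×[0,⌈(1+ε)n⌉])) > c', then Pr(V([0,n]×[0,100n])) > c. -/
open MeasureTheory

/-- A bond of the grid `ℤ²`: `(v, true)` is the bond joining `v` to `v + (1,0)`,
and `(v, false)` is the bond joining `v` to `v + (0,1)`. -/
abbrev GridBond : Type := (ℤ × ℤ) × Bool

/-- A percolation configuration: each bond is open (`true`) or closed (`false`). -/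
abbrev PercCfg : Type := GridBond → Bool

/-- The vertices `u` and `v` are adjacent in `ℤ²` and the bond joining them is
open in the configuration `ω`. -/
def BondOpen (ω : PercCfg) (u v : ℤ × ℤ) : Prop :=
  (v = (u.1 + 1, u.2) ∧ ω (u, true) = true) ∨
  (u = (v.1 + 1, v.2) ∧ ω (v, true) = true) ∨
  (v = (u.1, u.2 + 1) ∧ ω (u, false) = true) ∨
  (u = (v.1, v.2 + 1) ∧ ω (v, false) = true)

/-- `v` lies in the rectangle `[a,b] × [c,d]` of `ℤ²`. -/
def InRect (a b c d : ℤ) (v : ℤ × ℤ) : Prop :=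
  a ≤ v.1 ∧ v.1 ≤ b ∧ c ≤ v.2 ∧ v.2 ≤ d

/-- `Pth 0, Pth 1, …, Pth k` is an open lattice path in the rectangle
`[a,b] × [c,d]`. -/
def OpenPathIn (ω : PercCfg) (a b c d : ℤ) (k : ℕ) (Pth : ℕ → ℤ × ℤ) : Prop :=
  (∀ i ≤ k, InRect a b c d (Pth i)) ∧ ∀ i < k, BondOpen ω (Pth i) (Pth (i + 1))

/-- The event that `[a,b] × [c,d]` has an open horizontal crossing. -/
def HCross (a b c d : ℤ) : Set PercCfg :=
  {ω | ∃ k Pth, OpenPathIn ω a b c d k Pth ∧ (Pth 0).1 = a ∧ (Pth k).1 = b}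

/-- The event that `[a,b] × [c,d]` has an open vertical crossing. -/
def VCross (a b c d : ℤ) : Set PercCfg :=
  {ω | ∃ k Pth, OpenPathIn ω a b c d k Pth ∧ (Pth 0).2 = c ∧ (Pth k).2 = d}

/-- `Pr` is the i.i.d. Bernoulli(1/2) bond percolation measure on `ℤ²`: a
probability measure under which the states of the bonds are independent, each
open with probability `1/2`. -/
def IsBondPerc (Pr : Measure PercCfg) : Prop :=
  IsProbabilityMeasure Pr ∧
    ∀ (s : Finset GridBond) (f : GridBond → Bool),
      Pr {ω | ∀ e ∈ s, ω e = f e} = (1 / 2 : ENNReal) ^ s.card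

open scoped Classical in
/-- The set of bonds of the finite set `S` that are open in `ω`. -/
noncomputable def openBonds (S : Finset GridBond) (ω : PercCfg) : Finset S :=
  Finset.univ.filter fun e => ω e = true

/-- The event `E` is increasing and depends only on the states of the bonds in `S`. -/
def IncreasingOn (S : Finset GridBond) (E : Set PercCfg) : Prop :=
  ∀ ω ω' : PercCfg, (∀ e ∈ S, ω e = true → ω' e = true) → ω ∈ E → ω' ∈ E

theorem IncreasingOn.mono {S T : Finset GridBond} {E : Set PercCfg} (h : IncreasingOn S E)
    (hST : S ⊆ T) : IncreasingOn T E :=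
  fun ω ω' hω => h ω ω' fun e he => hω e (hST he)

theorem IncreasingOn.inter {S : Finset GridBond} {E F : Set PercCfg} (hE : IncreasingOn S E)
    (hF : IncreasingOn S F) : IncreasingOn S (E ∩ F) :=
  fun ω ω' hω h => ⟨hE ω ω' hω h.1, hF ω ω' hω h.2⟩

open scoped Classical in
/-- The patterns of open bonds in `S` realizing the event `E`. -/
noncomputable def patterns (S : Finset GridBond) (E : Set PercCfg) : Finset (Finset S) :=
  Finset.univ.filter fun A => ∃ ω ∈ E, openBonds S ω = A

theorem mem_openBonds {S : Finset GridBond} {ω : PercCfg} {e : S} :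
    e ∈ openBonds S ω ↔ ω e = true := by
  simp [openBonds]

theorem mem_patterns {S : Finset GridBond} {E : Set PercCfg} {A : Finset S} :
    A ∈ patterns S E ↔ ∃ ω ∈ E, openBonds S ω = A := by
  simp [patterns]

theorem openBonds_subset_iff {S : Finset GridBond} {ω ω' : PercCfg} :
    openBonds S ω ⊆ openBonds S ω' ↔ ∀ e ∈ S, ω e = true → ω' e = true := by
  simp [Finset.subset_iff, mem_openBonds]

theorem IncreasingOn.mem_iff {S : Finset GridBond} {E : Set PercCfg} (h : IncreasingOn S E)
    (ω : PercCfg) : ω ∈ E ↔ openBonds S ω ∈ patterns S E := by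
  rw [mem_patterns]
  refine ⟨fun hω => ⟨ω, hω, rfl⟩, ?_⟩
  rintro ⟨ω', hω', heq⟩
  exact h ω' ω (openBonds_subset_iff.1 heq.subset) hω'

open scoped Classical in
theorem exists_openBonds_eq (S : Finset GridBond) (A : Finset S) :
    ∃ ω : PercCfg, openBonds S ω = A := by
  refine ⟨fun e => decide (∃ h : e ∈ S, (⟨e, h⟩ : S) ∈ A), ?_⟩
  ext e
  simp [mem_openBonds]

theorem IncreasingOn.isUpperSet_patterns {S : Finset GridBond} {E : Set PercCfg}
    (h : IncreasingOn S E) : IsUpperSet (patterns S E : Set (Finset S)) := by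
  intro A B hAB hA
  obtain ⟨ω, hω, rfl⟩ := mem_patterns.1 (Finset.mem_coe.1 hA)
  obtain ⟨ω', rfl⟩ := exists_openBonds_eq S B
  exact Finset.mem_coe.2 ((h.mem_iff ω').1 (h ω ω' (openBonds_subset_iff.1 hAB) hω))

theorem openBonds_eq_iff {S : Finset GridBond} {ω ω' : PercCfg} :
    openBonds S ω = openBonds S ω' ↔ ∀ e ∈ S, ω e = ω' e := by
  rw [Finset.ext_iff, Subtype.forall]
  exact forall₂_congr fun e he => by rw [mem_openBonds, mem_openBonds, ← Bool.eq_iff_iff]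

theorem measurableSet_cylinder (S : Finset GridBond) (f : GridBond → Bool) :
    MeasurableSet {ω : PercCfg | ∀ e ∈ S, ω e = f e} := by
  have : {ω : PercCfg | ∀ e ∈ S, ω e = f e} = ⋂ e ∈ S, (fun ω : PercCfg => ω e) ⁻¹' {f e} := by
    ext ω; simp
  rw [this]
  exact Finset.measurableSet_biInter S fun e _ =>
    measurable_pi_apply e (measurableSet_singleton _)

theorem measurableSet_openBonds_fiber (S : Finset GridBond) (A : Finset S) :
    MeasurableSet (openBonds S ⁻¹' {A}) := by
  obtain ⟨f, rfl⟩ := exists_openBonds_eq S A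
  have : openBonds S ⁻¹' {openBonds S f} = {ω : PercCfg | ∀ e ∈ S, ω e = f e} := by
    ext ω; exact openBonds_eq_iff
  exact this ▸ measurableSet_cylinder S f

theorem IncreasingOn.eq_biUnion {S : Finset GridBond} {E : Set PercCfg}
    (h : IncreasingOn S E) : E = ⋃ A ∈ patterns S E, openBonds S ⁻¹' {A} := by
  ext ω
  simp [h.mem_iff ω]

theorem IncreasingOn.measurableSet {S : Finset GridBond} {E : Set PercCfg}
    (h : IncreasingOn S E) : MeasurableSet E := by
  rw [h.eq_biUnion]
  exact Finset.measurableSet_biUnion _ fun A _ => measurableSet_openBonds_fiber S A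

theorem IsBondPerc.measure_openBonds_fiber {Pr : Measure PercCfg} (hPr : IsBondPerc Pr)
    (S : Finset GridBond) (A : Finset S) :
    Pr (openBonds S ⁻¹' {A}) = (1 / 2 : ENNReal) ^ S.card := by
  obtain ⟨f, rfl⟩ := exists_openBonds_eq S A
  rw [← hPr.2 S f]
  congr 1
  ext ω
  exact openBonds_eq_iff

theorem IsBondPerc.measure_eq_card {Pr : Measure PercCfg} (hPr : IsBondPerc Pr)
    {S : Finset GridBond} {E : Set PercCfg} (h : IncreasingOn S E) :
    Pr E = (patterns S E).card * (1 / 2 : ENNReal) ^ S.card := by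
  conv_lhs => rw [h.eq_biUnion]
  rw [measure_biUnion_finset
    (fun A _ B _ hAB => (Set.disjoint_singleton.2 hAB).preimage _)
    fun A _ => measurableSet_openBonds_fiber S A]
  simp [hPr.measure_openBonds_fiber]

/-- **Harris' inequality** for increasing events depending on finitely many bonds. -/
theorem IsBondPerc.harris {Pr : Measure PercCfg} (hPr : IsBondPerc Pr)
    {S : Finset GridBond} {E F : Set PercCfg} (hE : IncreasingOn S E) (hF : IncreasingOn S F) :
    Pr E * Pr F ≤ Pr (E ∩ F) := by
  classical
  have hinter : patterns S (E ∩ F) = patterns S E ∩ patterns S F := by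
    ext A
    obtain ⟨ω, rfl⟩ := exists_openBonds_eq S A
    rw [Finset.mem_inter, ← hE.mem_iff, ← hF.mem_iff, ← (hE.inter hF).mem_iff, Set.mem_inter_iff]
  have hcard := hE.isUpperSet_patterns.le_card_inter_finset hF.isUpperSet_patterns
  rw [Fintype.card_coe] at hcard
  rw [hPr.measure_eq_card hE, hPr.measure_eq_card hF, hPr.measure_eq_card (hE.inter hF), hinter]
  have hcard' : ((patterns S E).card * (patterns S F).card : ENNReal)
      ≤ 2 ^ S.card * (patterns S E ∩ patterns S F).card := by exact_mod_cast hcard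
  have htwo : (2 : ENNReal) ^ S.card * (1 / 2) ^ S.card = 1 := by
    rw [← mul_pow, one_div, ENNReal.mul_inv_cancel two_ne_zero ENNReal.ofNat_ne_top, one_pow]
  calc _ = ((patterns S E).card * (patterns S F).card : ENNReal)
        * ((1 / 2) ^ S.card * (1 / 2) ^ S.card) := by ring
    _ ≤ 2 ^ S.card * (patterns S E ∩ patterns S F).card
        * ((1 / 2) ^ S.card * (1 / 2) ^ S.card) := by gcongr
    _ = (patterns S E ∩ patterns S F).card * (1 / 2) ^ S.card
        * (2 ^ S.card * (1 / 2) ^ S.card) := by ring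
    _ = _ := by rw [htwo, mul_one]

theorem measurable_relabel (σ : GridBond → GridBond) :
    Measurable fun (ω : PercCfg) e => ω (σ e) :=
  measurable_pi_lambda _ fun e => measurable_pi_apply (σ e)

theorem IsBondPerc.map_relabel {Pr : Measure PercCfg} (hPr : IsBondPerc Pr)
    (σ : GridBond ≃ GridBond) : IsBondPerc (Pr.map fun ω e => ω (σ e)) := by
  have := hPr.1
  refine ⟨Measure.isProbabilityMeasure_map (measurable_relabel σ).aemeasurable, fun s f => ?_⟩
  rw [Measure.map_apply (measurable_relabel σ) (measurableSet_cylinder s f),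
    ← Finset.card_map σ.toEmbedding, ← hPr.2 (s.map σ.toEmbedding) (fun e => f (σ.symm e))]
  congr 1
  ext ω
  simp only [Set.preimage_ofPred_eq, Set.mem_ofPred_eq, Finset.forall_mem_map,
    Equiv.coe_toEmbedding, Equiv.symm_apply_apply]

theorem IsBondPerc.measure_le_of_relabel {Pr : Measure PercCfg} (hPr : IsBondPerc Pr)
    (σ : GridBond ≃ GridBond) {S : Finset GridBond} {E F : Set PercCfg} (hE : IncreasingOn S E)
    (hEF : ∀ ω : PercCfg, (fun e => ω (σ e)) ∈ E → ω ∈ F) : Pr E ≤ Pr F := by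
  rw [hPr.measure_eq_card hE, ← (hPr.map_relabel σ).measure_eq_card hE,
    Measure.map_apply (measurable_relabel σ) hE.measurableSet]
  exact measure_mono hEF

/-- The bonds based at a vertex of the rectangle `[a,b] × [c,d]`. -/
noncomputable def rectBonds (a b c d : ℤ) : Finset GridBond :=
  (Finset.Icc a b ×ˢ Finset.Icc c d) ×ˢ Finset.univ

theorem mem_rectBonds {a b c d : ℤ} {v : ℤ × ℤ} (hv : InRect a b c d v) (t : Bool) :
    (v, t) ∈ rectBonds a b c d := by
  obtain ⟨h1, h2, h3, h4⟩ := hv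
  simp [rectBonds, h1, h2, h3, h4]

theorem OpenPathIn.mono {ω ω' : PercCfg} {a b c d : ℤ} {k : ℕ} {P : ℕ → ℤ × ℤ}
    (h : OpenPathIn ω a b c d k P)
    (hω : ∀ e ∈ rectBonds a b c d, ω e = true → ω' e = true) :
    OpenPathIn ω' a b c d k P := by
  refine ⟨h.1, fun i hi => ?_⟩
  have hu := h.1 i hi.le
  have hv := h.1 (i + 1) hi
  rcases h.2 i hi with ⟨h1, h2⟩ | ⟨h1, h2⟩ | ⟨h1, h2⟩ | ⟨h1, h2⟩
  · exact .inl ⟨h1, hω _ (mem_rectBonds hu _) h2⟩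
  · exact .inr (.inl ⟨h1, hω _ (mem_rectBonds hv _) h2⟩)
  · exact .inr (.inr (.inl ⟨h1, hω _ (mem_rectBonds hu _) h2⟩))
  · exact .inr (.inr (.inr ⟨h1, hω _ (mem_rectBonds hv _) h2⟩))

theorem increasingOn_VCross (a b c d : ℤ) : IncreasingOn (rectBonds a b c d) (VCross a b c d) := by
  rintro ω ω' hω ⟨k, P, hP, h0, hk⟩
  exact ⟨k, P, hP.mono hω, h0, hk⟩

theorem increasingOn_HCross (a b c d : ℤ) : IncreasingOn (rectBonds a b c d) (HCross a b c d) := by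
  rintro ω ω' hω ⟨k, P, hP, h0, hk⟩
  exact ⟨k, P, hP.mono hω, h0, hk⟩

/-- Translation by `(0, s)` acting on bonds. -/
def shiftBond (s : ℤ) : GridBond ≃ GridBond where
  toFun e := ((e.1.1, e.1.2 + s), e.2)
  invFun e := ((e.1.1, e.1.2 - s), e.2)
  left_inv e := by simp
  right_inv e := by simp

/-- Reflection in the diagonal followed by translation by `(0, s)`, acting on bonds. -/
def transposeShiftBond (s : ℤ) : GridBond ≃ GridBond where
  toFun e := ((e.1.2, e.1.1 + s), !e.2)
  invFun e := ((e.1.2 - s, e.1.1), !e.2)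
  left_inv e := by simp
  right_inv e := by simp

theorem IsBondPerc.measure_VCross_le_shift {Pr : Measure PercCfg} (hPr : IsBondPerc Pr)
    (a b c d s : ℤ) : Pr (VCross a b c d) ≤ Pr (VCross a b (c + s) (d + s)) := by
  refine hPr.measure_le_of_relabel (shiftBond s) (increasingOn_VCross a b c d) ?_
  rintro ω ⟨k, P, ⟨hR, hO⟩, h0, hk⟩
  refine ⟨k, fun i => ((P i).1, (P i).2 + s), ⟨fun i hi => ?_, fun i hi => ?_⟩, ?_, ?_⟩
  · have := hR i hi
    simp only [InRect] at this ⊢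
    omega
  · have := hO i hi
    simp only [BondOpen, shiftBond, Equiv.coe_fn_mk, Prod.ext_iff] at this ⊢
    rcases this with h | h | h | h
    · exact .inl ⟨by omega, h.2⟩
    · exact .inr (.inl ⟨by omega, h.2⟩)
    · exact .inr (.inr (.inl ⟨by omega, h.2⟩))
    · exact .inr (.inr (.inr ⟨by omega, h.2⟩))
  · simp [h0]
  · simp [hk]

theorem IsBondPerc.measure_VCross_le_HCross {Pr : Measure PercCfg} (hPr : IsBondPerc Pr)
    (a b c d s : ℤ) : Pr (VCross a b c d) ≤ Pr (HCross c d (a + s) (b + s)) := by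
  refine hPr.measure_le_of_relabel (transposeShiftBond s) (increasingOn_VCross a b c d) ?_
  rintro ω ⟨k, P, ⟨hR, hO⟩, h0, hk⟩
  refine ⟨k, fun i => ((P i).2, (P i).1 + s), ⟨fun i hi => ?_, fun i hi => ?_⟩, h0, hk⟩
  · have := hR i hi
    simp only [InRect] at this ⊢
    omega
  · have := hO i hi
    simp only [BondOpen, transposeShiftBond, Equiv.coe_fn_mk, Prod.ext_iff, Bool.not_true,
      Bool.not_false] at this ⊢
    rcases this with h | h | h | h
    · exact .inr (.inr (.inl ⟨by omega, h.2⟩))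
    · exact .inr (.inr (.inr ⟨by omega, h.2⟩))
    · exact .inl ⟨by omega, h.2⟩
    · exact .inr (.inl ⟨by omega, h.2⟩)

/-- Adjacency in the grid `ℤ²`. -/
def GridAdj (u v : ℤ × ℤ) : Prop :=
  (v.1 = u.1 + 1 ∧ v.2 = u.2) ∨ (u.1 = v.1 + 1 ∧ v.2 = u.2) ∨
    (v.1 = u.1 ∧ v.2 = u.2 + 1) ∨ (v.1 = u.1 ∧ u.2 = v.2 + 1)

theorem BondOpen.gridAdj {ω : PercCfg} {u v : ℤ × ℤ} (h : BondOpen ω u v) : GridAdj u v := by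
  simp only [BondOpen, Prod.ext_iff] at h
  simp only [GridAdj]
  omega

theorem BondOpen.symm {ω : PercCfg} {u v : ℤ × ℤ} (h : BondOpen ω u v) : BondOpen ω v u := by
  rcases h with h | h | h | h
  · exact .inr (.inl h)
  · exact .inl h
  · exact .inr (.inr (.inr h))
  · exact .inr (.inr (.inl h))

/-- The signed number of crossings, by the lattice step from `u` to `v`, of the horizontal ray
that starts at `(1/2, -1/2)` and points to the right. -/
def rayCrossing (u v : ℤ × ℤ) : ℤ :=
  if 0 < u.1 then (if 0 ≤ v.2 then 1 else 0) - (if 0 ≤ u.2 then 1 else 0) else 0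

/-- Crossings of the ray agree on the two sides of a lattice parallelogram avoiding the origin;
the parallelogram arises as the difference of a step of `p` and a step of `q`. -/
theorem rayCrossing_parallelogram {p p' q q' : ℤ × ℤ} (hp : GridAdj p p') (hq : GridAdj q q')
    (h00 : p ≠ q) (h10 : p' ≠ q) (h01 : p ≠ q') (h11 : p' ≠ q') :
    rayCrossing (p - q) (p' - q) + rayCrossing (p' - q) (p' - q') =
      rayCrossing (p - q) (p - q') + rayCrossing (p - q') (p' - q') := by
  simp only [GridAdj] at hp hq
  simp only [ne_eq, Prod.ext_iff] at h00 h10 h01 h11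
  simp only [rayCrossing, Prod.fst_sub, Prod.snd_sub]
  rcases hp with ⟨hp1, hp2⟩ | ⟨hp1, hp2⟩ | ⟨hp1, hp2⟩ | ⟨hp1, hp2⟩ <;>
    rcases hq with ⟨hq1, hq2⟩ | ⟨hq1, hq2⟩ | ⟨hq1, hq2⟩ | ⟨hq1, hq2⟩ <;>
    simp only [hp1, hp2, hq1, hq2] at h00 h10 h01 h11 ⊢ <;> split_ifs <;> omega

theorem sum_rayCrossing_of_pos (k : ℕ) (f : ℕ → ℤ × ℤ)
    (hadj : ∀ i < k, GridAdj (f i) (f (i + 1))) (hne : ∀ i ≤ k, f i ≠ 0)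
    (hpos : ∀ i ≤ k, 0 ≤ (f i).1) :
    ∑ i ∈ Finset.range k, rayCrossing (f i) (f (i + 1)) =
      (if 0 ≤ (f k).2 then 1 else 0) - (if 0 ≤ (f 0).2 then 1 else 0) := by
  rw [← Finset.sum_range_sub (fun i => if 0 ≤ (f i).2 then (1 : ℤ) else 0) k]
  refine Finset.sum_congr rfl fun i hi => ?_
  have hi := Finset.mem_range.1 hi
  have h1 := hadj i hi
  have h2 := hne i hi.le
  have h3 := hne (i + 1) hi
  have h4 := hpos i hi.le
  have h5 := hpos (i + 1) hi
  simp only [GridAdj, ne_eq, Prod.ext_iff, Prod.fst_zero, Prod.snd_zero] at h1 h2 h3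
  simp only [rayCrossing]
  split_ifs <;> omega

/-- A lattice path going from below to above and a lattice path going from left to right of each
other share a vertex. -/
theorem exists_common_vertex {k l : ℕ} {P Q : ℕ → ℤ × ℤ}
    (hP : ∀ i < k, GridAdj (P i) (P (i + 1))) (hQ : ∀ j < l, GridAdj (Q j) (Q (j + 1)))
    (hbot : ∀ j ≤ l, (P 0).2 ≤ (Q j).2) (htop : ∀ j ≤ l, (Q j).2 ≤ (P k).2)
    (hleft : ∀ i ≤ k, (Q 0).1 ≤ (P i).1) (hright : ∀ i ≤ k, (P i).1 ≤ (Q l).1) :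
    ∃ i ≤ k, ∃ j ≤ l, P i = Q j := by
  by_contra! hne
  set g : ℕ → ℤ := fun j => if 0 < (P 0 - Q j).1 ∧ 0 ≤ (P 0 - Q j).2 then 1 else 0 with hg
  set N : ℕ → ℤ := fun j => ∑ i ∈ Finset.range k, rayCrossing (P i - Q j) (P (i + 1) - Q j)
    with hN
  have hrow : ∀ j < l, ∀ m ≤ k,
      ∑ i ∈ Finset.range m, rayCrossing (P i - Q j) (P (i + 1) - Q j)
        + rayCrossing (P m - Q j) (P m - Q (j + 1)) =
      rayCrossing (P 0 - Q j) (P 0 - Q (j + 1)) +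
        ∑ i ∈ Finset.range m, rayCrossing (P i - Q (j + 1)) (P (i + 1) - Q (j + 1)) := by
    intro j hj m
    induction m with
    | zero => intro _; simp
    | succ m ih =>
      intro hm
      have := ih (by omega)
      have hpar := rayCrossing_parallelogram (hP m hm) (hQ j hj) (hne m (by omega) j hj.le)
        (hne (m + 1) hm j hj.le) (hne m (by omega) (j + 1) hj) (hne (m + 1) hm (j + 1) hj)
      rw [Finset.sum_range_succ, Finset.sum_range_succ]
      linarith
  have hstep : ∀ j < l, N (j + 1) + g (j + 1) = N j + g j := by
    intro j hj
    have h := hrow j hj k le_rfl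
    have htopside : rayCrossing (P k - Q j) (P k - Q (j + 1)) = 0 := by
      have h1 := htop j hj.le
      have h2 := htop (j + 1) hj
      simp only [rayCrossing, Prod.snd_sub]
      split_ifs <;> omega
    have hbotside : rayCrossing (P 0 - Q j) (P 0 - Q (j + 1)) = g (j + 1) - g j := by
      have h1 := hbot j hj.le
      have h2 := hbot (j + 1) hj
      have h3 := hne 0 (Nat.zero_le k) j hj.le
      have h4 := hne 0 (Nat.zero_le k) (j + 1) hj
      have h5 := hQ j hj
      simp only [GridAdj, ne_eq, Prod.ext_iff] at h3 h4 h5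
      simp only [hg, rayCrossing, Prod.fst_sub, Prod.snd_sub]
      split_ifs <;> omega
    simp only [hN]
    linarith
  have hconst : ∀ j ≤ l, N j + g j = N 0 + g 0 := by
    intro j
    induction j with
    | zero => intro _; rfl
    | succ j ih => intro hj; rw [hstep j hj, ih (by omega)]
  have hlast : N l = 0 := by
    refine Finset.sum_eq_zero fun i hi => ?_
    have h1 := hright i (Finset.mem_range.1 hi).le
    simp only [rayCrossing, Prod.fst_sub]
    split_ifs <;> omega
  have hglast : g l = 0 := by
    have h1 := hright 0 (Nat.zero_le k)
    simp only [hg, Prod.fst_sub]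
    split_ifs <;> omega
  have hfirst := sum_rayCrossing_of_pos k (fun i => P i - Q 0)
    (fun i hi => by
      have := hP i hi
      simp only [GridAdj, Prod.fst_sub, Prod.snd_sub] at this ⊢
      omega)
    (fun i hi => sub_ne_zero.2 (hne i hi 0 (Nat.zero_le l)))
    (fun i hi => by simpa using hleft i hi)
  have h := hconst l le_rfl
  rw [hlast, hglast] at h
  simp only [hN, hfirst, hg, Prod.fst_sub, Prod.snd_sub] at h
  have h1 := htop 0 (Nat.zero_le l)
  have h2 := hleft 0 (Nat.zero_le k)
  have h3 := hbot 0 (Nat.zero_le l)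
  have h4 := hne 0 (Nat.zero_le k) 0 (Nat.zero_le l)
  simp only [ne_eq, Prod.ext_iff] at h4
  split_ifs at h <;> omega

/-- `u` and `v` are joined by an open bond inside the rectangle `[a,b] × [c,d]`. -/
def OpenStepIn (ω : PercCfg) (a b c d : ℤ) (u v : ℤ × ℤ) : Prop :=
  InRect a b c d u ∧ InRect a b c d v ∧ BondOpen ω u v

instance (ω : PercCfg) (a b c d : ℤ) : Std.Symm (OpenStepIn ω a b c d) :=
  ⟨fun _ _ h => ⟨h.2.1, h.1, h.2.2.symm⟩⟩

theorem InRect.mono {a b c d c' d' : ℤ} {v : ℤ × ℤ} (hv : InRect a b c d v) (hc : c' ≤ c)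
    (hd : d ≤ d') : InRect a b c' d' v :=
  ⟨hv.1, hv.2.1, hc.trans hv.2.2.1, hv.2.2.2.trans hd⟩

theorem OpenPathIn.widen {ω : PercCfg} {a b c d c' d' : ℤ} {k : ℕ} {P : ℕ → ℤ × ℤ}
    (h : OpenPathIn ω a b c d k P) (hc : c' ≤ c) (hd : d ≤ d') : OpenPathIn ω a b c' d' k P :=
  ⟨fun i hi => (h.1 i hi).mono hc hd, h.2⟩

theorem OpenPathIn.reflTransGen_zero {ω : PercCfg} {a b c d : ℤ} {k : ℕ} {P : ℕ → ℤ × ℤ}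
    (h : OpenPathIn ω a b c d k P) {i : ℕ} (hi : i ≤ k) :
    Relation.ReflTransGen (OpenStepIn ω a b c d) (P 0) (P i) := by
  induction i with
  | zero => exact .refl
  | succ i ih =>
    exact (ih (by omega)).tail ⟨h.1 i (by omega), h.1 (i + 1) hi, h.2 i hi⟩

theorem OpenPathIn.reflTransGen {ω : PercCfg} {a b c d : ℤ} {k : ℕ} {P : ℕ → ℤ × ℤ}
    (h : OpenPathIn ω a b c d k P) {i j : ℕ} (hi : i ≤ k) (hj : j ≤ k) :
    Relation.ReflTransGen (OpenStepIn ω a b c d) (P i) (P j) :=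
  (symm (h.reflTransGen_zero hi)).trans (h.reflTransGen_zero hj)

theorem exists_openPathIn {ω : PercCfg} {a b c d : ℤ} {u v : ℤ × ℤ} (hu : InRect a b c d u)
    (h : Relation.ReflTransGen (OpenStepIn ω a b c d) u v) :
    ∃ k P, OpenPathIn ω a b c d k P ∧ P 0 = u ∧ P k = v := by
  induction h with
  | refl => exact ⟨0, fun _ => u, ⟨fun _ _ => hu, fun _ hi => absurd hi (by omega)⟩, rfl, rfl⟩
  | @tail v w _ hvw ih =>
    obtain ⟨k, P, hP, h0, hk⟩ := ih
    refine ⟨k + 1, fun i => if i ≤ k then P i else w, ⟨fun i hi => ?_, fun i hi => ?_⟩, ?_, ?_⟩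
    · by_cases hik : i ≤ k
      · simpa [hik] using hP.1 i hik
      · simpa [hik] using hvw.2.1
    · by_cases hik : i + 1 ≤ k
      · simpa [hik, Nat.le_of_succ_le hik] using hP.2 i hik
      · obtain rfl : i = k := by omega
        simpa [hk] using hvw.2.2
    · simpa using h0
    · simp

/-- Two vertical crossings of overlapping rectangles and a horizontal crossing of the overlap give
a vertical crossing of the union. -/
theorem VCross_inter_VCross_inter_HCross_subset {a b c s t d : ℤ} (hcs : c ≤ s) (htd : t ≤ d) :
    VCross a b c t ∩ VCross a b s d ∩ HCross a b s t ⊆ VCross a b c d := by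
  rintro ω ⟨⟨⟨k, P, hP, hP0, hPk⟩, ⟨k', P', hP', hP'0, hP'k⟩⟩, ⟨l, Q, hQ, hQ0, hQl⟩⟩
  obtain ⟨i, hi, j, hj, hij⟩ := exists_common_vertex (P := P) (Q := Q) (k := k) (l := l)
    (fun i hi => (hP.2 i hi).gridAdj) (fun j hj => (hQ.2 j hj).gridAdj)
    (fun j hj => by have := (hQ.1 j hj).2.2.1; omega)
    (fun j hj => by have := (hQ.1 j hj).2.2.2; omega)
    (fun i hi => by have := (hP.1 i hi).1; omega)
    (fun i hi => by have := (hP.1 i hi).2.1; omega)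
  obtain ⟨i', hi', j', hj', hij'⟩ := exists_common_vertex (P := P') (Q := Q) (k := k') (l := l)
    (fun i hi => (hP'.2 i hi).gridAdj) (fun j hj => (hQ.2 j hj).gridAdj)
    (fun j hj => by have := (hQ.1 j hj).2.2.1; omega)
    (fun j hj => by have := (hQ.1 j hj).2.2.2; omega)
    (fun i hi => by have := (hP'.1 i hi).1; omega)
    (fun i hi => by have := (hP'.1 i hi).2.1; omega)
  have hP := hP.widen le_rfl htd
  have hP' := hP'.widen hcs le_rfl
  have hQ := hQ.widen hcs htd
  have hconn := (hP.reflTransGen (Nat.zero_le k) hi).trans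
    (((hij ▸ hQ.reflTransGen hj hj' : Relation.ReflTransGen _ (P i) (Q j'))).trans
      (hij' ▸ hP'.reflTransGen hi' le_rfl))
  obtain ⟨m, R, hR, hR0, hRm⟩ := exists_openPathIn (hP.1 0 (Nat.zero_le k)) hconn
  exact ⟨m, R, hR, by rw [hR0, hP0], by rw [hRm, hP'k]⟩

theorem VCross_subset_VCross {a b c d d' : ℤ} (hc : c ≤ d) (hd : d ≤ d') :
    VCross a b c d' ⊆ VCross a b c d := by
  rintro ω ⟨k, P, hP, h0, hk⟩
  have hex : ∃ i, d ≤ (P i).2 := ⟨k, by omega⟩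
  set m := Nat.find hex with hm
  have hmk : m ≤ k := Nat.find_min' hex (by omega)
  have hlt : ∀ i < m, (P i).2 < d := fun i hi => not_le.1 (Nat.find_min hex hi)
  have hmd : d ≤ (P m).2 := Nat.find_spec hex
  have hmeq : (P m).2 = d := by
    rcases Nat.eq_zero_or_pos m with h | h
    · rw [h] at hmd ⊢
      omega
    · obtain ⟨i, hi⟩ := Nat.exists_eq_add_of_lt h
      have h1 := hlt i (by omega)
      have h2 := (hP.2 i (by omega)).gridAdj
      simp only [GridAdj] at h2
      rw [show m = i + 1 by omega] at hmd ⊢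
      omega
  refine ⟨m, P, ⟨fun i hi => ?_, fun i hi => hP.2 i (by omega)⟩, h0, hmeq⟩
  have h1 := hP.1 i (by omega)
  refine ⟨h1.1, h1.2.1, h1.2.2.1, ?_⟩
  rcases hi.lt_or_eq with h | h
  · exact (hlt i h).le
  · exact (h ▸ hmeq).le

/-- Doubling the excess of the height of a rectangle over its width at most cubes the crossing
probability. -/
theorem IsBondPerc.pow_three_le_measure_VCross {Pr : Measure PercCfg} (hPr : IsBondPerc Pr)
    {n m : ℤ} (hn : 0 ≤ n) (hm : 0 ≤ m) :
    Pr (VCross 0 n 0 (n + m)) ^ 3 ≤ Pr (VCross 0 n 0 (n + 2 * m)) := by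
  classical
  set S := rectBonds 0 n 0 (n + m) ∪ rectBonds 0 n m (n + 2 * m) ∪ rectBonds 0 n m (n + m)
  have h1 : IncreasingOn S (VCross 0 n 0 (n + m)) :=
    (increasingOn_VCross _ _ _ _).mono
      (Finset.subset_union_left.trans Finset.subset_union_left)
  have h2 : IncreasingOn S (VCross 0 n m (n + 2 * m)) :=
    (increasingOn_VCross _ _ _ _).mono
      (Finset.subset_union_right.trans Finset.subset_union_left)
  have h3 : IncreasingOn S (HCross 0 n m (n + m)) :=
    (increasingOn_HCross _ _ _ _).mono Finset.subset_union_right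
  have hshift : Pr (VCross 0 n 0 (n + m)) ≤ Pr (VCross 0 n m (n + 2 * m)) := by
    have h := hPr.measure_VCross_le_shift 0 n 0 (n + m) m
    rwa [zero_add, show n + m + m = n + 2 * m by ring] at h
  have hsquare : Pr (VCross 0 n 0 (n + m)) ≤ Pr (HCross 0 n m (n + m)) := by
    refine (measure_mono (VCross_subset_VCross hn (by omega))).trans ?_
    simpa using hPr.measure_VCross_le_HCross 0 n 0 n m
  calc Pr (VCross 0 n 0 (n + m)) ^ 3
      = Pr (VCross 0 n 0 (n + m)) * Pr (VCross 0 n 0 (n + m)) * Pr (VCross 0 n 0 (n + m)) := by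
        ring
    _ ≤ Pr (VCross 0 n 0 (n + m)) * Pr (VCross 0 n m (n + 2 * m)) * Pr (HCross 0 n m (n + m)) := by
        gcongr
    _ ≤ Pr (VCross 0 n 0 (n + m) ∩ VCross 0 n m (n + 2 * m)) * Pr (HCross 0 n m (n + m)) := by
        gcongr
        exact hPr.harris h1 h2
    _ ≤ Pr (VCross 0 n 0 (n + m) ∩ VCross 0 n m (n + 2 * m) ∩ HCross 0 n m (n + m)) :=
        hPr.harris (h1.inter h2) h3
    _ ≤ Pr (VCross 0 n 0 (n + 2 * m)) :=
        measure_mono (VCross_inter_VCross_inter_HCross_subset hm (by omega))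

theorem IsBondPerc.pow_le_measure_VCross {Pr : Measure PercCfg} (hPr : IsBondPerc Pr)
    {n m : ℤ} (hn : 0 ≤ n) (hm : 0 ≤ m) (K : ℕ) :
    Pr (VCross 0 n 0 (n + m)) ^ 3 ^ K ≤ Pr (VCross 0 n 0 (n + 2 ^ K * m)) := by
  induction K with
  | zero => simp
  | succ K ih =>
    calc Pr (VCross 0 n 0 (n + m)) ^ 3 ^ (K + 1)
        = (Pr (VCross 0 n 0 (n + m)) ^ 3 ^ K) ^ 3 := by rw [← pow_mul, pow_succ]
      _ ≤ Pr (VCross 0 n 0 (n + 2 ^ K * m)) ^ 3 := by gcongr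
      _ ≤ Pr (VCross 0 n 0 (n + 2 * (2 ^ K * m))) :=
          hPr.pow_three_le_measure_VCross hn (by positivity)
      _ = Pr (VCross 0 n 0 (n + 2 ^ (K + 1) * m)) := by rw [pow_succ']; ring_nf

/-- **From slightly-taller rectangles to long rectangles** (Lemma 5.4): for
every `ε > 0` and `c' > 0` there is `c > 0` such that for every `n ≥ 1`, if
`Pr(V([0,n] × [0,⌈(1+ε)n⌉])) > c'` then `Pr(V([0,n] × [0,100n])) > c`. -/
theorem taller_to_long_rectangles (ε : ℝ) (hε : 0 < ε)
    (c' : ENNReal) (hc' : 0 < c') :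
    ∃ c : ENNReal, 0 < c ∧
      ∀ Pr : Measure PercCfg, IsBondPerc Pr →
        ∀ (n : ℕ), 1 ≤ n →
          c' < Pr (VCross 0 (n : ℤ) 0 ⌈(1 + ε) * (n : ℝ)⌉) →
          c < Pr (VCross 0 (n : ℤ) 0 (100 * (n : ℤ))) := by
  obtain ⟨K, hK⟩ := pow_unbounded_of_one_lt (99 / ε) (one_lt_two (α := ℝ))
  refine ⟨c' ^ 3 ^ K, ENNReal.pow_pos hc' _, fun Pr hPr n _ hlt => ?_⟩
  set m : ℤ := ⌈ε * (n : ℝ)⌉ with hm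
  have hm0 : 0 ≤ m := Int.ceil_nonneg (by positivity)
  have hceil : ⌈(1 + ε) * (n : ℝ)⌉ = (n : ℤ) + m := by
    rw [hm, one_add_mul, Int.ceil_natCast_add]
  have hheight : 100 * (n : ℤ) ≤ n + 2 ^ K * m := by
    have h1 : 99 ≤ 2 ^ K * ε := ((div_lt_iff₀ hε).1 hK).le
    have h2 : (99 : ℝ) * n ≤ 2 ^ K * m := by
      calc (99 : ℝ) * n ≤ 2 ^ K * ε * n := by gcongr
        _ = 2 ^ K * (ε * n) := by ring
        _ ≤ 2 ^ K * m := by gcongr; exact Int.le_ceil _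
    have h3 : 99 * (n : ℤ) ≤ 2 ^ K * m := by exact_mod_cast h2
    linarith
  rw [hceil] at hlt
  calc c' ^ 3 ^ K < Pr (VCross 0 n 0 (n + m)) ^ 3 ^ K :=
        ENNReal.pow_lt_pow_left (by positivity) hlt
    _ ≤ Pr (VCross 0 n 0 (n + 2 ^ K * m)) :=
        hPr.pow_le_measure_VCross (Int.natCast_nonneg n) hm0 K
    _ ≤ Pr (VCross 0 n 0 (100 * n)) :=
        measure_mono (VCross_subset_VCross (by positivity) hheight)
end

section
/- Interlaced vertical crossings of a rectangle must meet: Let a ≤ b and c ≤ d be integers and let R be the set of (x,y) ∈ ℤ² with a ≤ x ≤ b and c ≤ y ≤ d. Let v_0, …, v_k be a lattice path in R from (x_1, c) to (x_1', d), and let w_0, …, w_l be a lattice path in R from (x_2, c) to (x_2', d). If x_1 ≤ x_2 and x_2' ≤ x_1', then the two paths share a vertex: v_i = w_j for some indices i and j. -/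
/-- `u` and `v` are adjacent in the grid `ℤ²`, i.e. at `ℓ¹`-distance `1`. -/
def Adj (u v : ℤ × ℤ) : Prop := |u.1 - v.1| + |u.2 - v.2| = 1

/-- The four possible directions of an edge of the grid. -/
lemma Adj.cases {u v : ℤ × ℤ} (h : Adj u v) :
    (v.1 = u.1 ∧ (v.2 = u.2 + 1 ∨ u.2 = v.2 + 1)) ∨
      (v.2 = u.2 ∧ (v.1 = u.1 + 1 ∨ u.1 = v.1 + 1)) := by
  unfold Adj at h
  rcases abs_cases (u.1 - v.1) with h1 | h1 <;> rcases abs_cases (u.2 - v.2) with h2 | h2 <;> omega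

/-- The indicator, modulo `2`, of the event that the edge `uv` is crossed by the leftward
horizontal ray starting from `p + (0, 1/2)`. -/
def rayCrosses (u v p : ℤ × ℤ) : ZMod 2 :=
  if u.1 = v.1 ∧ u.1 < p.1 ∧ min u.2 v.2 = p.2 ∧ u.2 ≠ v.2 then 1 else 0

/-- The indicator, modulo `2`, of `u` being strictly to the left of `p` on the same row. -/
def leftOf (u p : ℤ × ℤ) : ZMod 2 :=
  if u.2 = p.2 ∧ u.1 < p.1 then 1 else 0

/-- The number, modulo `2`, of crossings of the first `k` edges of the path `v` with the leftward
horizontal ray starting from `p + (0, 1/2)`. -/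
def rayCrossings (v : ℕ → ℤ × ℤ) (k : ℕ) (p : ℤ × ℤ) : ZMod 2 :=
  ∑ i ∈ Finset.range k, rayCrosses (v i) (v (i + 1)) p

lemma rayCrosses_right {u v : ℤ × ℤ} {x y : ℤ} (hu : u ≠ (x, y)) (hv : v ≠ (x, y)) :
    rayCrosses u v (x + 1, y) = rayCrosses u v (x, y) := by
  obtain ⟨u1, u2⟩ := u
  obtain ⟨v1, v2⟩ := v
  simp only [ne_eq, Prod.mk.injEq] at hu hv
  simp only [rayCrosses]
  congr 1
  apply propext
  constructor <;> intro h <;> omega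

lemma rayCrosses_add_up {u v : ℤ × ℤ} {x y : ℤ} (h : Adj u v)
    (hu : u ≠ (x, y + 1)) (hv : v ≠ (x, y + 1)) :
    rayCrosses u v (x, y) + rayCrosses u v (x, y + 1) =
      leftOf u (x, y + 1) + leftOf v (x, y + 1) := by
  obtain ⟨u1, u2⟩ := u
  obtain ⟨v1, v2⟩ := v
  have hc := h.cases
  simp only [ne_eq, Prod.mk.injEq] at hu hv hc
  simp only [rayCrosses, leftOf]
  split_ifs <;> first | decide | (exfalso; omega)

lemma rayCrossings_right {v : ℕ → ℤ × ℤ} {k : ℕ} {x y : ℤ} (hv : ∀ i ≤ k, v i ≠ (x, y)) :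
    rayCrossings v k (x + 1, y) = rayCrossings v k (x, y) :=
  Finset.sum_congr rfl fun i hi ↦
    have hi := Finset.mem_range.1 hi
    rayCrosses_right (hv i hi.le) (hv (i + 1) hi)

lemma rayCrossings_add_up {v : ℕ → ℤ × ℤ} {k : ℕ} {x y : ℤ}
    (hA : ∀ i < k, Adj (v i) (v (i + 1))) (hv : ∀ i ≤ k, v i ≠ (x, y + 1)) :
    rayCrossings v k (x, y) + rayCrossings v k (x, y + 1) =
      leftOf (v 0) (x, y + 1) + leftOf (v k) (x, y + 1) := by
  induction k with
  | zero => simp [rayCrossings, CharTwo.add_self_eq_zero]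
  | succ k ih =>
    have ih := ih (fun i hi ↦ hA i (by omega)) (fun i hi ↦ hv i (by omega))
    have step := rayCrosses_add_up (hA k (by omega)) (hv k (by omega)) (hv (k + 1) le_rfl)
    simp only [rayCrossings, Finset.sum_range_succ] at ih ⊢
    have h2 := CharTwo.add_self_eq_zero (leftOf (v k) (x, y + 1))
    linear_combination ih + step + h2

/-- The ray-crossing parity of a path, where the path is prolonged by an upward edge from its
endpoint `v k`, is the same at adjacent points off the path whose rows lie between those of its
endpoints. -/
lemma rayCrossings_add_leftOf_eq {v : ℕ → ℤ × ℤ} {k : ℕ} {p q : ℤ × ℤ}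
    (hA : ∀ i < k, Adj (v i) (v (i + 1))) (hpq : Adj p q)
    (hp : ∀ i ≤ k, v i ≠ p) (hq : ∀ i ≤ k, v i ≠ q)
    (hp0 : (v 0).2 ≤ p.2) (hq0 : (v 0).2 ≤ q.2) (hpk : p.2 ≤ (v k).2) (hqk : q.2 ≤ (v k).2) :
    rayCrossings v k p + leftOf (v k) p = rayCrossings v k q + leftOf (v k) q := by
  have up (x y : ℤ) (h : ∀ i ≤ k, v i ≠ (x, y + 1)) (h0 : (v 0).2 ≤ y) (hk : y + 1 ≤ (v k).2) :
      rayCrossings v k (x, y) + leftOf (v k) (x, y) =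
        rayCrossings v k (x, y + 1) + leftOf (v k) (x, y + 1) := by
    have e := rayCrossings_add_up hA h
    have e0 : leftOf (v 0) (x, y + 1) = 0 := if_neg (by simp only; omega)
    have ek : leftOf (v k) (x, y) = 0 := if_neg (by simp only; omega)
    have h2 := CharTwo.add_self_eq_zero (rayCrossings v k (x, y + 1))
    linear_combination e + e0 + ek - h2
  have right (x y : ℤ) (h : ∀ i ≤ k, v i ≠ (x, y)) :
      rayCrossings v k (x, y) + leftOf (v k) (x, y) =
        rayCrossings v k (x + 1, y) + leftOf (v k) (x + 1, y) := by
    rw [rayCrossings_right h]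
    congr 1
    have hne : ¬ ((v k).1 = x ∧ (v k).2 = y) := fun e ↦ h k le_rfl (Prod.ext e.1 e.2)
    simp only [leftOf]
    congr 1
    apply propext
    constructor <;> intro h <;> omega
  have hc := hpq.cases
  obtain ⟨p1, p2⟩ := p
  obtain ⟨q1, q2⟩ := q
  simp only at hc hp0 hq0 hpk hqk
  rcases hc with ⟨rfl, rfl | rfl⟩ | ⟨rfl, rfl | rfl⟩
  · exact up _ _ hq hp0 hqk
  · exact (up _ _ hp hq0 hpk).symm
  · exact right _ _ hp
  · exact (right _ _ hq).symm

/-- **Interlaced vertical crossings of a rectangle must meet**: if a lattice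
path in `R = [a,b]×[c,d]` runs from `(x₁, c)` to `(x₁', d)`, another from
`(x₂, c)` to `(x₂', d)`, and `x₁ ≤ x₂` while `x₂' ≤ x₁'`, then the two paths
share a vertex. -/
theorem interlaced_vertical_crossings_meet (a b c d : ℤ) (hab : a ≤ b) (hcd : c ≤ d)
    (k l : ℕ) (v w : ℕ → ℤ × ℤ)
    (hvR : ∀ i ≤ k, InRect a b c d (v i))
    (hvA : ∀ i < k, Adj (v i) (v (i + 1)))
    (hv0 : (v 0).2 = c) (hvk : (v k).2 = d)
    (hwR : ∀ j ≤ l, InRect a b c d (w j))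
    (hwA : ∀ j < l, Adj (w j) (w (j + 1)))
    (hw0 : (w 0).2 = c) (hwl : (w l).2 = d)
    (hx : (v 0).1 ≤ (w 0).1) (hx' : (w l).1 ≤ (v k).1) :
    ∃ i ≤ k, ∃ j ≤ l, v i = w j := by
  by_contra! hne
  have key (j : ℕ) (hj : j ≤ l) : rayCrossings v k (w j) + leftOf (v k) (w j) =
      rayCrossings v k (w 0) + leftOf (v k) (w 0) := by
    induction j with
    | zero => rfl
    | succ j ih =>
      rw [← ih (by omega)]
      obtain ⟨-, -, h1, h2⟩ := hwR j (by omega)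
      obtain ⟨-, -, h3, h4⟩ := hwR (j + 1) hj
      exact (rayCrossings_add_leftOf_eq hvA (hwA j hj) (fun i hi ↦ hne i hi j (by omega))
        (fun i hi ↦ hne i hi (j + 1) hj) (by omega) (by omega) (by omega) (by omega)).symm
  have zero_of_outside (p : ℤ × ℤ) (hp : p.2 < c ∨ d ≤ p.2) : rayCrossings v k p = 0 := by
    refine Finset.sum_eq_zero fun i hi ↦ if_neg ?_
    have hi := Finset.mem_range.1 hi
    obtain ⟨-, -, h1, h2⟩ := hvR i hi.le
    obtain ⟨-, -, h3, h4⟩ := hvR (i + 1) hi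
    omega
  have hl : rayCrossings v k (w l) + leftOf (v k) (w l) = 0 := by
    rw [zero_of_outside _ (Or.inr hwl.ge), zero_add]
    exact if_neg (by omega)
  have h0 : rayCrossings v k (w 0) + leftOf (v k) (w 0) = 1 := by
    have hw : w 0 = ((w 0).1, c - 1 + 1) := Prod.ext rfl (by simp [hw0])
    have e := rayCrossings_add_up (x := (w 0).1) (y := c - 1) hvA
      (fun i hi ↦ hw ▸ hne i hi 0 (Nat.zero_le l))
    rw [zero_of_outside _ (Or.inl (by simp)), ← hw, zero_add] at e
    have hlt : (v 0).1 < (w 0).1 := lt_of_le_of_ne hx fun h ↦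
      hne 0 (Nat.zero_le k) 0 (Nat.zero_le l) (Prod.ext h (hv0.trans hw0.symm))
    have e0 : leftOf (v 0) (w 0) = 1 := if_pos ⟨hv0.trans hw0.symm, hlt⟩
    rw [e, e0, add_assoc, CharTwo.add_self_eq_zero, add_zero]
  exact zero_ne_one (hl.symm.trans ((key l le_rfl).trans h0))
end
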